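/- arXiv:1301.2486 — 5 statements merged into one kernel-verified Lean document; each statement's English description precedes it below -/
import Mathlib

section
/- There are at most r = dim_C W tuples j = (j_1, …, j_n) ∈ {1, …, ℓ}^n such that W_j := W_{1,j_1} ∩ W_{2,j_2} ∩ ⋯ ∩ W_{n,j_n} ≠ {0}. Equivalently, the set { j ∈ {1,…,ℓ}^n : W_j ≠ {0} } is finite of cardinality at most r. -/
/-- The intersections `⨅ i, p i (j i)`, over all choices `j` of one member of each of finitely many
independent families of submodules, form an independent family. -/
theorem iSupIndep_iInf_apply {R M ι : Type*} [Ring R] [AddCommGroup M] [Module R M] [Finite ι]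
    {κ : ι → Type*} {p : ∀ i, κ i → Submodule R M} (hp : ∀ i, iSupIndep (p i)) :
    iSupIndep fun j : (∀ i, κ i) => ⨅ i, p i (j i) := by
  classical
  have := Fintype.ofFinite ι
  rw [iSupIndep_iff_finsetSum_eq_zero_imp_eq_zero]
  intro s v hv hsum k hk
  have key : ∀ t : Finset ι, ∑ j ∈ s with ∀ i ∈ t, j i = k i, v j = 0 := by
    intro t
    induction t using Finset.induction_on with
    | empty => simpa using hsum
    | insert a t _ ih =>
      set u := s.filter fun j => ∀ i ∈ t, j i = k i with hu
      have hfib : ∑ x ∈ u.image (· a), ∑ j ∈ u with j a = x, v j = 0 := by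
        rwa [Finset.sum_fiberwise_of_maps_to (g := fun j : (∀ i, κ i) => j a)
          fun j hj => Finset.mem_image_of_mem (fun j : (∀ i, κ i) => j a) hj]
      have hzero := (iSupIndep_iff_finsetSum_eq_zero_imp_eq_zero (p a)).1 (hp a) _ _
        (fun x _ => Submodule.sum_mem _ fun j hj => by
          obtain ⟨hju, rfl⟩ := Finset.mem_filter.1 hj
          exact (Submodule.mem_iInf _).1 (hv j (Finset.mem_filter.1 hju).1) a)
        hfib (k a) (Finset.mem_image_of_mem (· a) (Finset.mem_filter.2 ⟨hk, fun _ _ => rfl⟩))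
      rw [hu, Finset.filter_filter] at hzero
      simpa only [Finset.forall_mem_insert, and_comm] using hzero
  simpa [← funext_iff, Finset.filter_eq', hk] using key Finset.univ

/-- Lemma 1: if `W` is a finite-dimensional vector space over a field `C` and, for each
`i ∈ {1,…,n}`, `(Wsub i 1, …, Wsub i ℓ)` is an independent family of subspaces of `W`
(i.e. each `Wsub i j` intersects the sum of the others trivially), then there are at most
`dim_C W` tuples `j = (j₁,…,jₙ)` with `Wsub 1 j₁ ∩ ⋯ ∩ Wsub n jₙ ≠ {0}`. -/
theorem at_most_r_tuples_with_nontrivial_intersection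
    {C : Type*} [Field C] {W : Type*} [AddCommGroup W] [Module C W]
    [FiniteDimensional C W] (n ℓ : ℕ) (hn : 1 ≤ n) (hℓ : 1 ≤ ℓ)
    (Wsub : Fin n → Fin ℓ → Submodule C W)
    (hind : ∀ (i : Fin n) (j : Fin ℓ), Wsub i j ⊓ (⨆ j' ≠ j, Wsub i j') = ⊥) :
    {j : Fin n → Fin ℓ | (⨅ i, Wsub i (j i)) ≠ ⊥}.ncard ≤ Module.finrank C W := by
  classical
  have h := (iSupIndep_iInf_apply fun i =>
    iSupIndep_def.2 fun j => disjoint_iff.2 (hind i j)).subtype_ne_bot_le_finrank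
  rwa [← Nat.card_eq_fintype_card] at h
end

section
/- For every fixed index k ∈ {1,…,ℓ}, the number of tuples j = (j_1,…,j_n) ∈ {1,…,ℓ}^n with first component j_1 = k and W_j := W_{1,j_1} ∩ ⋯ ∩ W_{n,j_n} ≠ {0} is at most dim_C W_{1,k}. -/
/-- If `p i` is an independent family of submodules for each `i` in a finite type, then the
intersections `⨅ i, p i (j i)`, indexed by the choice functions `j`, are independent. -/
theorem iSupIndep_iInf_pi {R M ι : Type*} [Ring R] [AddCommGroup M] [Module R M] [Finite ι]
    {κ : ι → Type*} {p : ∀ i, κ i → Submodule R M} (hp : ∀ i, iSupIndep (p i)) :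
    iSupIndep fun j : ∀ i, κ i ↦ ⨅ i, p i (j i) := by
  classical
  cases nonempty_fintype ι
  simp only [iSupIndep_iff_finsetSum_eq_zero_imp_eq_zero] at hp ⊢
  intro s v hv hsum j₀ hj₀
  have key (I : Finset ι) : ∑ j ∈ s with ∀ i ∈ I, j i = j₀ i, v j = 0 := by
    induction I using Finset.induction_on with
    | empty => simpa using hsum
    | insert i I _ ih =>
      set t := s.filter fun j ↦ ∀ i ∈ I, j i = j₀ i with ht
      have hfib := Finset.sum_fiberwise_of_maps_to
        (fun j hj ↦ Finset.mem_image_of_mem (fun j : ∀ i, κ i ↦ j i) hj) v (s := t)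
      have hzero := hp i (t.image fun j ↦ j i) (fun a ↦ ∑ j ∈ t with j i = a, v j)
        (fun a _ ↦ Submodule.sum_mem _ fun j hj ↦ by
          obtain ⟨hjt, rfl⟩ := Finset.mem_filter.1 hj
          exact (Submodule.mem_iInf _).1 (hv j (Finset.mem_filter.1 hjt).1) i)
        (hfib.trans ih) (j₀ i) (Finset.mem_image_of_mem _ (by simp [ht, hj₀]))
      rw [← hzero, ht, Finset.filter_filter]
      congr 1
      ext j
      simp only [Finset.mem_filter, Finset.forall_mem_insert]
      tauto
  have hfilter : s.filter (fun j ↦ ∀ i ∈ Finset.univ, j i = j₀ i) = {j₀} := by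
    ext j
    rw [Finset.mem_filter, Finset.mem_singleton]
    exact ⟨fun h ↦ funext fun i ↦ h.2 i (Finset.mem_univ i), by rintro rfl; exact ⟨hj₀, by simp⟩⟩
  simpa only [hfilter, Finset.sum_singleton] using key Finset.univ


/-- For a fixed index `k`, the number of tuples `j = (j₁,…,jₙ)` with first component `k`
and `Wsub 1 j₁ ∩ ⋯ ∩ Wsub n jₙ ≠ {0}` is at most `dim_C (Wsub 1 k)`. -/
theorem tuples_with_fixed_first_component
    {C : Type*} [Field C] {W : Type*} [AddCommGroup W] [Module C W]
    [FiniteDimensional C W] (n ℓ : ℕ) (hn : 0 < n) (hℓ : 1 ≤ ℓ)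
    (Wsub : Fin n → Fin ℓ → Submodule C W)
    (hind : ∀ (i : Fin n) (j : Fin ℓ), Wsub i j ⊓ (⨆ j' ≠ j, Wsub i j') = ⊥)
    (k : Fin ℓ) :
    {j : Fin n → Fin ℓ | j ⟨0, hn⟩ = k ∧ (⨅ i, Wsub i (j i)) ≠ ⊥}.ncard
      ≤ Module.finrank C (Wsub ⟨0, hn⟩ k) := by
  classical
  have hq : iSupIndep fun j : Fin n → Fin ℓ ↦ ⨅ i, Wsub i (j i) :=
    iSupIndep_iInf_pi fun i j ↦ disjoint_iff.2 (hind i j)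
  set S := {j : Fin n → Fin ℓ | j ⟨0, hn⟩ = k ∧ (⨅ i, Wsub i (j i)) ≠ ⊥}
  choose v hv hv0 using fun j : S ↦ Submodule.exists_mem_ne_zero_of_ne_bot j.2.2
  have hli : LinearIndependent C v :=
    iSupIndep.linearIndependent _ (hq.comp Subtype.val_injective) hv hv0
  have hmem (j : S) : v j ∈ Wsub ⟨0, hn⟩ k := by
    have h := (Submodule.mem_iInf _).1 (hv j) ⟨0, hn⟩
    rwa [j.2.1] at h
  have hli' : LinearIndependent C fun j ↦ (⟨v j, hmem j⟩ : Wsub ⟨0, hn⟩ k) :=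
    LinearIndependent.of_comp (Wsub ⟨0, hn⟩ k).subtype hli
  rw [← Nat.card_coe_set_eq, Nat.card_eq_fintype_card]
  exact hli'.fintype_card_le_finrank
end

section
/- The sum over all tuples j ∈ {1,…,ℓ}^n of the dimensions of the intersection spaces is bounded by the dimension of W: Σ_{j ∈ {1,…,ℓ}^n} dim_C (W_{1,j_1} ∩ ⋯ ∩ W_{n,j_n}) ≤ dim_C W = r. -/
/-- The dimension of the span of a finite independent family of subspaces is the sum of their
dimensions. -/
theorem iSupIndep.finrank_iSup {ι K V : Type*} [Fintype ι] [Field K] [AddCommGroup V] [Module K V]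
    [FiniteDimensional K V] {p : ι → Submodule K V} (hp : iSupIndep p) :
    Module.finrank K (⨆ i, p i : Submodule K V) = ∑ i, Module.finrank K (p i) := by
  classical
  rw [Submodule.iSup_eq_range_dfinsupp_lsum, LinearMap.finrank_range_of_inj
    hp.dfinsupp_lsum_injective]
  exact Module.finrank_directSum K fun i => p i

/-- Intersecting a fixed subspace `U` with the members of finitely many independent families, one
member from each family, gives subspaces whose dimensions sum to at most that of `U`. -/
theorem Submodule.sum_finrank_inf_iInf_le {κ K V : Type*} [Fintype κ] [Field K] [AddCommGroup V]
    [Module K V] [FiniteDimensional K V] {n : ℕ} (p : Fin n → κ → Submodule K V)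
    (hp : ∀ i, iSupIndep (p i)) (U : Submodule K V) :
    ∑ j : Fin n → κ, Module.finrank K (U ⊓ ⨅ i, p i (j i) : Submodule K V)
      ≤ Module.finrank K U := by
  induction n generalizing U with
  | zero => simpa using Submodule.finrank_mono inf_le_left
  | succ n ih =>
    rw [← (Fin.consEquiv fun _ => κ).sum_comp, Fintype.sum_prod_type]
    calc
      _ = ∑ k, ∑ j : Fin n → κ,
            Module.finrank K ((U ⊓ p 0 k) ⊓ ⨅ i, p i.succ (j i) : Submodule K V) := by
        refine Fintype.sum_congr _ _ fun k => Fintype.sum_congr _ _ fun j => ?_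
        have h : (⨅ i, p i ((Fin.cons k j : Fin (n + 1) → κ) i))
            = p 0 k ⊓ ⨅ i, p i.succ (j i) :=
          eq_of_forall_le_iff fun _ => by simp [Fin.forall_fin_succ]
        rw [inf_assoc, ← h]
        rfl
      _ ≤ ∑ k, Module.finrank K (U ⊓ p 0 k : Submodule K V) :=
        Finset.sum_le_sum fun k _ => ih (fun i => p i.succ) (fun i => hp i.succ) _
      _ = Module.finrank K (⨆ k, U ⊓ p 0 k : Submodule K V) :=
        ((hp 0).mono fun _ => inf_le_right).finrank_iSup.symm
      _ ≤ Module.finrank K U := Submodule.finrank_mono (iSup_le fun _ => inf_le_left)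

/-- The sum over all tuples `j ∈ {1,…,ℓ}ⁿ` of the dimensions of the intersection spaces
`W_j = Wsub 1 j₁ ∩ ⋯ ∩ Wsub n jₙ` is bounded by `dim_C W`. -/
theorem sum_of_dims_of_intersections_le
    {C : Type*} [Field C] {W : Type*} [AddCommGroup W] [Module C W]
    [FiniteDimensional C W] (n ℓ : ℕ) (hn : 1 ≤ n) (hℓ : 1 ≤ ℓ)
    (Wsub : Fin n → Fin ℓ → Submodule C W)
    (hind : ∀ (i : Fin n) (j : Fin ℓ), Wsub i j ⊓ (⨆ j' ≠ j, Wsub i j') = ⊥) :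
    ∑ j : Fin n → Fin ℓ, Module.finrank C (⨅ i, Wsub i (j i) : Submodule C W)
      ≤ Module.finrank C W := by
  calc
    _ = ∑ j : Fin n → Fin ℓ, Module.finrank C (⊤ ⊓ ⨅ i, Wsub i (j i) : Submodule C W) :=
      Fintype.sum_congr _ _ fun j => by rw [top_inf_eq]
    _ ≤ Module.finrank C (⊤ : Submodule C W) :=
      Submodule.sum_finrank_inf_iInf_le Wsub
        (fun i => iSupIndep_def.mpr fun j => disjoint_iff.mpr (hind i j)) ⊤
    _ = Module.finrank C W := finrank_top C W
end

section
/- Let β_1, …, β_t be pairwise distinct real numbers and c_1, …, c_t ∈ ℂ. If the function z ↦ Σ_{q=1}^t c_q · exp(i·β_q·log z), defined for real z > 0, tends to 0 as z → 0 from the right (equivalently, if for all λ > 0 the function z ↦ Σ_q c_q (λz)^{iβ_q} tends to 0 as z → 0⁺), then c_1 = ⋯ = c_t = 0. -/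
open Filter Topology in
/-- An exponential sum with pairwise distinct real frequencies that tends to `0` at `-∞` has all
its coefficients equal to `0`. -/
theorem exp_sum_coeff_eq_zero_of_tendsto_atBot {ι : Type*} (β : ι → ℝ) (S : Finset ι)
    (hβ : Set.InjOn β S) (c : ι → ℂ)
    (h : Tendsto (fun x : ℝ => ∑ q ∈ S, c q * Complex.exp (Complex.I * (β q : ℂ) * (x : ℂ)))
      atBot (𝓝 0)) :
    ∀ q ∈ S, c q = 0 := by
  classical
  induction S using Finset.induction_on generalizing c with
  | empty => simp
  | insert a S ha ih =>
    have hS : ∀ q ∈ S, c q = 0 := by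
      intro q hq
      have hne : β q - β a ≠ 0 := sub_ne_zero.2 fun he =>
        ha (hβ (by simp [hq]) (by simp) he ▸ hq)
      set s : ℝ := Real.pi / (β q - β a) with hs
      -- translating by `s` and subtracting a multiple of the original sum kills the `a` term
      have h₁ := (h.comp (tendsto_atBot_add_const_right atBot s tendsto_id)).sub
        (h.const_mul (Complex.exp (Complex.I * (β a : ℂ) * (s : ℂ))))
      have h₂ := ih (hβ.mono (by simp))
        (fun r => c r * (Complex.exp (Complex.I * (β r : ℂ) * (s : ℂ)) -
          Complex.exp (Complex.I * (β a : ℂ) * (s : ℂ)))) (by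
          rw [mul_zero, sub_zero] at h₁
          refine h₁.congr fun x => ?_
          simp only [Function.comp_apply, id_eq, Finset.mul_sum]
          rw [← Finset.sum_sub_distrib, Finset.sum_insert ha]
          push_cast
          simp only [mul_add, Complex.exp_add]
          rw [show ∀ u v w : ℂ, u * (v * w) - w * (u * v) = 0 by intros; ring, zero_add]
          exact Finset.sum_congr rfl fun r _ => by ring) q hq
      refine (mul_eq_zero.1 h₂).resolve_right fun h₃ => ?_
      have hexp : Complex.I * (β q : ℂ) * (s : ℂ)
          = Complex.I * (β a : ℂ) * (s : ℂ) + Real.pi * Complex.I := by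
        have : (β q - β a) * s = Real.pi := by rw [hs]; field_simp
        rw [← this]
        push_cast
        ring
      rw [hexp, Complex.exp_add, Complex.exp_pi_mul_I] at h₃
      exact Complex.exp_ne_zero (Complex.I * (β a : ℂ) * (s : ℂ)) (by linear_combination -h₃ / 2)
    have hnorm : Tendsto (fun _ : ℝ => ‖c a‖) atBot (𝓝 0) := by
      refine (tendsto_zero_iff_norm_tendsto_zero.1 h).congr fun x => ?_
      rw [Finset.sum_insert ha, Finset.sum_eq_zero fun q hq => by rw [hS q hq, zero_mul],
        add_zero, norm_mul, mul_assoc, ← Complex.ofReal_mul, mul_comm Complex.I,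
        Complex.norm_exp_ofReal_mul_I, mul_one]
    have hca : c a = 0 := norm_eq_zero.1 (tendsto_nhds_unique tendsto_const_nhds hnorm)
    simpa [hca] using hS

/-- If `β₁, …, β_t` are pairwise distinct real numbers, `c₁, …, c_t ∈ ℂ`, and the function
`z ↦ Σ_q c_q · exp(i·β_q·log z)` (for real `z > 0`) tends to `0` as `z → 0⁺`, then
all the `c_q` vanish. -/
theorem coeffs_vanish_of_tendsto_zero
    (t : ℕ) (β : Fin t → ℝ) (hβ : Function.Injective β) (c : Fin t → ℂ)
    (h : Filter.Tendsto
      (fun z : ℝ => ∑ q : Fin t, c q * Complex.exp (Complex.I * (β q : ℂ) * (Real.log z : ℂ)))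
      (nhdsWithin 0 (Set.Ioi 0)) (nhds 0)) :
    ∀ q : Fin t, c q = 0 := by
  have hexp := h.comp Real.tendsto_exp_atBot_nhdsGT
  simp only [Function.comp_def, Real.log_exp] at hexp
  exact fun q => exp_sum_coeff_eq_zero_of_tendsto_atBot β Finset.univ hβ.injOn c hexp q
    (Finset.mem_univ q)
end

section
/- Let E be a differential field with derivation d and let C = {c ∈ E : d(c) = 0} be its field of constants. Let r ≥ 0 and p_0, …, p_r ∈ E with p_r ≠ 0. Then the solution set V = { y ∈ E : p_r·d^r(y) + p_{r-1}·d^{r-1}(y) + ⋯ + p_0·y = 0 } is a C-vector subspace of E of dimension at most r over C. -/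
/-- A nonzero subspace of `ι → E` that is stable under entrywise application of a derivation `d`
contains a nonzero vector all of whose entries are constants. -/
theorem Submodule.exists_ne_zero_forall_deriv_eq_zero {E ι : Type*} [Field E] [Fintype ι]
    (d : E → E) (d_zero : d 0 = 0) (d_one : d 1 = 0) (S : Submodule E (ι → E)) (hS : S ≠ ⊥)
    (hd : ∀ c ∈ S, (fun j => d (c j)) ∈ S) :
    ∃ c ∈ S, c ≠ 0 ∧ ∀ j, d (c j) = 0 := by
  classical
  obtain ⟨c, ⟨hcS, hc0⟩, hmin⟩ := exists_minimalFor_of_wellFoundedLT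
    (fun c : ι → E => c ∈ S ∧ c ≠ 0) (fun c => Finset.univ.filter fun j => c j ≠ 0)
    (S.exists_mem_ne_zero_of_ne_bot hS)
  obtain ⟨k, hk⟩ := Function.ne_iff.mp hc0
  have hk : c k ≠ 0 := hk
  have hb : (c k)⁻¹ • c ∈ S := S.smul_mem _ hcS
  refine ⟨(c k)⁻¹ • c, hb, smul_ne_zero (inv_ne_zero hk) hc0, ?_⟩
  by_contra! ⟨j, hj⟩
  have hle := hmin ⟨hd _ hb, Function.ne_iff.mpr ⟨j, hj⟩⟩ (fun i hi => by
    simp only [Finset.mem_filter, Finset.mem_univ, true_and] at hi ⊢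
    intro h
    simp [h, d_zero] at hi)
  have hmem := hle (show k ∈ _ by simpa using hk)
  simp [hk, d_one] at hmem

/-- In a differential field `(E, d)` with field of constants `C = {c | d c = 0}`, the
solution set `V = {y | p_r·dʳ(y) + ⋯ + p_0·y = 0}` (where `p_r ≠ 0`) is a `C`-vector
subspace of `E`: it contains `0`, is closed under addition and under multiplication by
constants; and it has dimension at most `r` over `C`: any `r + 1` elements of `V` are
linearly dependent over the constants. -/
theorem solution_space_dimension_le_order
    {E : Type*} [Field E] (d : E → E)
    (hadd : ∀ a b : E, d (a + b) = d a + d b)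
    (hmul : ∀ a b : E, d (a * b) = d a * b + a * d b)
    (r : ℕ) (p : Fin (r + 1) → E) (hp : p (Fin.last r) ≠ 0)
    (V : Set E) (hV : V = {y : E | ∑ i : Fin (r + 1), p i * d^[(i : ℕ)] y = 0}) :
    (0 : E) ∈ V ∧
    (∀ y₁ y₂ : E, y₁ ∈ V → y₂ ∈ V → y₁ + y₂ ∈ V) ∧
    (∀ c y : E, d c = 0 → y ∈ V → c * y ∈ V) ∧
    (∀ y : Fin (r + 1) → E, (∀ i, y i ∈ V) →
      ∃ c : Fin (r + 1) → E, (∀ i, d (c i) = 0) ∧ (∃ i, c i ≠ 0) ∧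
        ∑ i : Fin (r + 1), c i * y i = 0) := by
  have d_zero : d 0 = 0 := by simpa using hadd 0 0
  have d_one : d 1 = 0 := by simpa using hmul 1 1
  let D : E →+ E := AddMonoidHom.mk' d hadd
  have iter_zero (n : ℕ) : d^[n] 0 = 0 := iterate_map_zero D n
  have iter_add (n : ℕ) (a b : E) : d^[n] (a + b) = d^[n] a + d^[n] b := iterate_map_add D n a b
  have iter_const (n : ℕ) (c a : E) (hc : d c = 0) : d^[n] (c * a) = c * d^[n] a := by
    induction n with
    | zero => rfl
    | succ n ih => rw [Function.iterate_succ_apply', ih, hmul, hc, zero_mul, zero_add,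
        Function.iterate_succ_apply']
  subst hV
  refine ⟨by simp [iter_zero], fun y₁ y₂ h₁ h₂ => ?_, fun c y hc hy => ?_, fun y hy => ?_⟩
  · simp only [Set.mem_ofPred_eq] at *
    simp [iter_add, mul_add, Finset.sum_add_distrib, h₁, h₂]
  · simp only [Set.mem_ofPred_eq] at *
    simp only [iter_const _ c y hc, mul_left_comm _ c, ← Finset.mul_sum, hy, mul_zero]
  · simp only [Set.mem_ofPred_eq] at hy
    let W : Matrix (Fin r) (Fin (r + 1)) E := .of fun i j => d^[(i : ℕ)] (y j)
    have mem_ker (c : Fin (r + 1) → E) : c ∈ LinearMap.ker W.mulVecLin ↔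
        ∀ n < r, ∑ j, c j * d^[n] (y j) = 0 := by
      simp [funext_iff, Matrix.mulVec, dotProduct, W, Fin.forall_iff, mul_comm]
    have sum_eq_zero {c : Fin (r + 1) → E} (hc : c ∈ LinearMap.ker W.mulVecLin) (n : ℕ)
        (hn : n ≤ r) : ∑ j, c j * d^[n] (y j) = 0 := by
      rw [mem_ker] at hc
      rcases hn.lt_or_eq with hn | rfl
      · exact hc n hn
      have h : ∑ i : Fin (n + 1), p i * ∑ j, c j * d^[(i : ℕ)] (y j) = 0 := by
        simp only [Finset.mul_sum, mul_left_comm _ (c _)]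
        rw [Finset.sum_comm]
        simp only [← Finset.mul_sum, hy, mul_zero, Finset.sum_const_zero]
      rw [Fin.sum_univ_castSucc] at h
      simpa [hc, hp] using h
    have hbot : LinearMap.ker W.mulVecLin ≠ ⊥ := LinearMap.ker_ne_bot_of_finrank_lt (by simp)
    obtain ⟨c, hc, hc0, hconst⟩ := Submodule.exists_ne_zero_forall_deriv_eq_zero d d_zero d_one
      _ hbot fun c hc => (mem_ker _).mpr fun n hn => by
        have h : D (∑ j, c j * d^[n] (y j)) = 0 := by rw [sum_eq_zero hc n hn.le, map_zero]
        rw [map_sum] at h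
        simpa [D, hmul, Finset.sum_add_distrib, ← Function.iterate_succ_apply',
          -Function.iterate_succ, sum_eq_zero hc (n + 1) hn] using h
    exact ⟨c, hconst, Function.ne_iff.mp hc0, sum_eq_zero hc 0 r.zero_le⟩
end
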